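/- arXiv:1707.02679 — 5 statements merged into one kernel-verified Lean document; each statement's English description precedes it below -/
import Mathlib

section
/- Let α ∈ (0,1), σ = 1 - α/2, and fix an integer j ≥ 1. Then the coefficients c_s^{(α,σ)} are strictly decreasing in s: c_0^{(α,σ)} > c_1^{(α,σ)} > c_2^{(α,σ)} > ⋯ > c_{j-1}^{(α,σ)} > c_j^{(α,σ)}. -/
/-- `a_l^{(α,σ)}`: `a_0 = σ^{1-α}`, `a_l = (l+σ)^{1-α} - (l-1+σ)^{1-α}` for `l ≥ 1`. -/
noncomputable def aC (α σ : ℝ) (l : ℕ) : ℝ :=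
  if l = 0 then σ ^ (1 - α)
  else ((l : ℝ) + σ) ^ (1 - α) - ((l : ℝ) - 1 + σ) ^ (1 - α)

/-- `b_l^{(α,σ)}` for `l ≥ 1`. -/
noncomputable def bC (α σ : ℝ) (l : ℕ) : ℝ :=
  (((l : ℝ) + σ) ^ (2 - α) - ((l : ℝ) - 1 + σ) ^ (2 - α)) / (2 - α)
    - (((l : ℝ) + σ) ^ (1 - α) - ((l : ℝ) - 1 + σ) ^ (1 - α)) / 2

/-- `c_s^{(α,σ)}` with top index `j`. -/
noncomputable def cC (α σ : ℝ) (j s : ℕ) : ℝ :=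
  if j = 0 then aC α σ 0
  else if s = 0 then aC α σ 0 + bC α σ 1
  else if s = j then aC α σ j - bC α σ j
  else aC α σ s + bC α σ (s + 1) - bC α σ s

/-- The quantity underlying `bC`, as a function of a real node `x`, is positive. -/
lemma rpow_trapezoid_pos {α x : ℝ} (h0 : 0 < α) (h1 : α < 1) (hx : 0 < x) :
    0 < ((x + 1) ^ (2 - α) - x ^ (2 - α)) / (2 - α) - ((x + 1) ^ (1 - α) - x ^ (1 - α)) / 2 := by
  have e : ∀ y : ℝ, 0 < y → y ^ (2 - α) = y * y ^ (1 - α) := fun y hy => by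
    rw [show 2 - α = 1 + (1 - α) by ring, Real.rpow_add hy, Real.rpow_one]
  rw [e x hx, e (x + 1) (by linarith)]
  have hlt : x ^ (1 - α) < (x + 1) ^ (1 - α) :=
    Real.rpow_lt_rpow hx.le (by linarith) (by linarith)
  have hpos : 0 < x ^ (1 - α) := Real.rpow_pos_of_pos hx _
  rw [sub_pos, div_lt_div_iff₀ two_pos (by linarith)]
  nlinarith [mul_pos hx (sub_pos.2 hlt), mul_pos h0 (sub_pos.2 hlt)]

lemma bC_pos {α σ : ℝ} (h0 : 0 < α) (h1 : α < 1) (hσ : 0 < σ) (l : ℕ) :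
    0 < bC α σ (l + 1) := by
  have h := rpow_trapezoid_pos h0 h1 (x := l + σ) (by positivity)
  unfold bC
  push_cast
  rw [show (l : ℝ) + 1 + σ = l + σ + 1 by ring, show (l : ℝ) + 1 - 1 + σ = l + σ by ring]
  exact h

/-- The value of `cC` at interior indices, as a function of a real node `x = s + σ`. -/
noncomputable def interiorCoeff (α x : ℝ) : ℝ :=
  ((x + 1) ^ (2 - α) - 2 * x ^ (2 - α) + (x - 1) ^ (2 - α)) / (2 - α)
    - (x + 1) ^ (1 - α) / 2 + 2 * x ^ (1 - α) - 3 / 2 * (x - 1) ^ (1 - α)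

lemma aC_add_bC_sub_bC (α σ : ℝ) {s : ℕ} (hs : s ≠ 0) :
    aC α σ s + bC α σ (s + 1) - bC α σ s = interiorCoeff α (s + σ) := by
  unfold aC bC interiorCoeff
  rw [if_neg hs]
  push_cast
  rw [show (s : ℝ) + 1 + σ = s + σ + 1 by ring, show (s : ℝ) + 1 - 1 + σ = s + σ by ring,
    show (s : ℝ) - 1 + σ = s + σ - 1 by ring]
  ring

lemma hasDerivAt_interiorCoeff {α x : ℝ} (h1 : α < 1) (hx : 1 < x) :
    HasDerivAt (interiorCoeff α)
      ((x + 1) ^ (1 - α) - 2 * x ^ (1 - α) + (x - 1) ^ (1 - α)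
        + (1 - α) * (-(x + 1) ^ (-α) / 2 + 2 * x ^ (-α) - 3 / 2 * (x - 1) ^ (-α))) x := by
  have d : ∀ c p : ℝ, 0 < x + c →
      HasDerivAt (fun y : ℝ => (y + c) ^ p) (p * (x + c) ^ (p - 1)) x := fun c p hc => by
    simpa using ((hasDerivAt_id x).add_const c).rpow_const (p := p) (Or.inl hc.ne')
  have P := fun p => d 1 p (by linarith)
  have Z := fun p => d 0 p (by linarith)
  have M := fun p => d (-1) p (by linarith)
  simp only [add_zero, ← sub_eq_add_neg] at Z M
  have h2 : 2 - α ≠ 0 := by linarith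
  refine HasDerivAt.congr_deriv (f := interiorCoeff α) (((((((P (2 - α)).sub ((Z (2 - α)).const_mul 2)).add (M (2 - α))).div_const (2 - α)).sub
    ((P (1 - α)).div_const 2)).add ((Z (1 - α)).const_mul 2)).sub
      ((M (1 - α)).const_mul (3 / 2))) ?_
  rw [show 2 - α - 1 = 1 - α by ring, show 1 - α - 1 = -α by ring]
  field_simp
  ring

/-- Midpoint convexity of a power with nonpositive exponent. -/
lemma two_mul_midpoint_rpow_le {a b r : ℝ} (ha : 0 < a) (hb : 0 < b) (hr : r ≤ 0) :
    2 * ((a + b) / 2) ^ r ≤ a ^ r + b ^ r := by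
  have sq : ∀ y : ℝ, 0 < y → y ^ r = y ^ (r / 2) * y ^ (r / 2) := fun y hy => by
    rw [← Real.rpow_add hy, add_halves]
  have hm : 0 < (a + b) / 2 := by positivity
  have hle : ((a + b) / 2) ^ r ≤ a ^ (r / 2) * b ^ (r / 2) := by
    rw [sq _ hm, ← Real.mul_rpow hm.le hm.le, ← Real.mul_rpow ha.le hb.le]
    exact Real.rpow_le_rpow_of_nonpos (by positivity) (by nlinarith [sq_nonneg (a - b)])
      (by linarith)
  rw [sq a ha, sq b hb]
  nlinarith [sq_nonneg (a ^ (r / 2) - b ^ (r / 2))]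

lemma interiorCoeff_strictAntiOn {α : ℝ} (h0 : 0 < α) (h1 : α < 1) :
    StrictAntiOn (interiorCoeff α) (Set.Ioi 1) := by
  refine strictAntiOn_of_deriv_neg (convex_Ioi 1)
    (fun x hx => (hasDerivAt_interiorCoeff h1 hx).continuousAt.continuousWithinAt) ?_
  intro x hx
  rw [interior_Ioi, Set.mem_Ioi] at hx
  rw [(hasDerivAt_interiorCoeff h1 hx).deriv]
  have hconc := (Real.strictConcaveOn_rpow (p := 1 - α) (by linarith) (by linarith)).2
    (Set.mem_Ici.2 (by linarith : (0 : ℝ) ≤ x + 1)) (Set.mem_Ici.2 (by linarith : 0 ≤ x - 1))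
    (by linarith) (one_half_pos (α := ℝ)) one_half_pos (by norm_num)
  have mid : (1 / 2 : ℝ) * (x + 1) + 1 / 2 * (x - 1) = x := by ring
  simp only [smul_eq_mul, mid] at hconc
  have hconv := two_mul_midpoint_rpow_le (a := x + 1) (b := x - 1) (r := -α) (by linarith)
    (by linarith) (by linarith)
  rw [show (x + 1 + (x - 1)) / 2 = x by ring] at hconv
  have hanti : (x + 1) ^ (-α) < (x - 1) ^ (-α) :=
    Real.rpow_lt_rpow_of_neg (by linarith) (by linarith) (by linarith)
  have hneg : -(x + 1) ^ (-α) / 2 + 2 * x ^ (-α) - 3 / 2 * (x - 1) ^ (-α) < 0 := by linarith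
  linarith [mul_neg_of_pos_of_neg (sub_pos.2 h1) hneg]

/-- The inequality `c_0 > c_1` after clearing denominators; here `1 - α = 2σ - 1`. -/
lemma two_mul_rpow_lt {σ : ℝ} (h0 : 1 / 2 < σ) (h1 : σ < 1) :
    2 * (2 + σ) ^ (2 * σ - 1) <
      4 * σ * σ ^ (2 * σ - 1) + (3 - 2 * σ) * (1 + σ) ^ (2 * σ - 1) := by
  have hσ : 0 < σ := by linarith
  set p := 2 * σ - 1 with hp
  set A := (1 + σ) ^ p with hA
  have hA0 : 0 < A := Real.rpow_pos_of_pos (by linarith) _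
  have up : (2 + σ) ^ p ≤ (1 + p * (1 / (1 + σ))) * A := by
    have := rpow_one_add_le_one_add_mul_self (s := 1 / (1 + σ)) (p := p)
      (by have : 0 < 1 / (1 + σ) := by positivity
          linarith) (by linarith) (by linarith)
    rw [show 2 + σ = (1 + 1 / (1 + σ)) * (1 + σ) by field_simp; ring,
      Real.mul_rpow (by positivity) (by positivity)]
    exact mul_le_mul_of_nonneg_right this hA0.le
  have low : A ≤ (1 + p * (1 / σ)) * σ ^ p := by
    have := rpow_one_add_le_one_add_mul_self (s := 1 / σ) (p := p)
      (by have : 0 < 1 / σ := by positivity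
          linarith) (by linarith) (by linarith)
    rw [hA, show 1 + σ = (1 + 1 / σ) * σ by field_simp; ring,
      Real.mul_rpow (by positivity) (by positivity)]
    exact mul_le_mul_of_nonneg_right this (by positivity)
  have h3 : 0 < 3 * σ - 1 := by linarith
  have h3' : σ * 3 - 1 ≠ 0 := by linarith
  have low' : σ / (3 * σ - 1) * A ≤ σ ^ p := by
    rw [show 1 + p * (1 / σ) = (3 * σ - 1) / σ by rw [hp]; field_simp; ring] at low
    calc σ / (3 * σ - 1) * A ≤ σ / (3 * σ - 1) * ((3 * σ - 1) / σ * σ ^ p) := by gcongr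
      _ = σ ^ p := by field_simp
  have key : 2 * (1 + p * (1 / (1 + σ))) < 4 * σ * (σ / (3 * σ - 1)) + (3 - 2 * σ) := by
    have e : 4 * σ * (σ / (3 * σ - 1)) + (3 - 2 * σ) - 2 * (1 + p * (1 / (1 + σ)))
        = (1 - σ) * (2 * σ ^ 2 + 11 * σ - 3) / ((3 * σ - 1) * (1 + σ)) := by
      rw [hp]
      field_simp
      ring
    have : 0 < (1 - σ) * (2 * σ ^ 2 + 11 * σ - 3) / ((3 * σ - 1) * (1 + σ)) :=
      div_pos (mul_pos (by linarith) (by nlinarith)) (by positivity)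
    linarith
  calc 2 * (2 + σ) ^ p ≤ 2 * (1 + p * (1 / (1 + σ))) * A := by linarith
    _ < (4 * σ * (σ / (3 * σ - 1)) + (3 - 2 * σ)) * A := by gcongr
    _ = 4 * σ * (σ / (3 * σ - 1) * A) + (3 - 2 * σ) * A := by ring
    _ ≤ 4 * σ * σ ^ p + (3 - 2 * σ) * A := by gcongr

lemma interiorCoeff_one_add_lt {α σ : ℝ} (h0 : 0 < α) (h1 : α < 1) (hσ : σ = 1 - α / 2) :
    interiorCoeff α (1 + σ) < aC α σ 0 + bC α σ 1 := by
  obtain rfl : α = 2 - 2 * σ := by linarith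
  have hσ0 : 0 < σ := by linarith
  have e : ∀ y : ℝ, 0 < y → y ^ (2 * σ) = y * y ^ (2 * σ - 1) := fun y hy => by
    rw [Real.rpow_sub_one hy.ne']
    field_simp
  have key := two_mul_rpow_lt (σ := σ) (by linarith) (by linarith)
  simp only [interiorCoeff, aC, bC, if_true, Nat.cast_one]
  rw [show 1 + σ + 1 = 2 + σ by ring, show 1 + σ - 1 = σ by ring, show 1 - 1 + σ = σ by ring,
    show 2 - (2 - 2 * σ) = 2 * σ by ring, show 1 - (2 - 2 * σ) = 2 * σ - 1 by ring,
    e σ hσ0, e (1 + σ) (by linarith), e (2 + σ) (by linarith), ← sub_pos]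
  generalize σ ^ (2 * σ - 1) = f₀ at *
  generalize (1 + σ) ^ (2 * σ - 1) = f₁ at *
  generalize (2 + σ) ^ (2 * σ - 1) = f₂ at *
  have : 0 < (4 * σ * f₀ + (3 - 2 * σ) * f₁ - 2 * f₂) / (2 * σ) :=
    div_pos (by linarith) (by linarith)
  convert this using 1
  field_simp
  ring

/-- At every positive index, `cC` is at most the corresponding interior value. -/
lemma cC_le_interiorCoeff {α σ : ℝ} (h0 : 0 < α) (h1 : α < 1) (hσ : 0 < σ) (j : ℕ) {s : ℕ}
    (hs : s ≠ 0) (hj : j ≠ 0) : cC α σ j s ≤ interiorCoeff α (s + σ) := by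
  rw [← aC_add_bC_sub_bC α σ hs, cC, if_neg hj, if_neg hs]
  split_ifs with h
  · subst h
    linarith [bC_pos h0 h1 hσ s]
  · exact le_rfl

/-- The coefficients `c_s^{(α,σ)}` (top index `j ≥ 1`) are strictly decreasing in `s`. -/
theorem coeff_strict_decreasing (α : ℝ) (hα : 0 < α ∧ α < 1) (σ : ℝ)
    (hσ : σ = 1 - α / 2) (j : ℕ) (hj : 1 ≤ j) :
    ∀ s : ℕ, s < j → cC α σ j (s + 1) < cC α σ j s := by
  obtain ⟨h0, h1⟩ := hα
  have hσ0 : 0 < σ := by linarith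
  intro s hs
  have hle := cC_le_interiorCoeff h0 h1 hσ0 j s.succ_ne_zero (by omega)
  refine hle.trans_lt ?_
  rcases Nat.eq_zero_or_pos s with rfl | hpos
  · rw [cC, if_neg (by omega), if_pos rfl]
    simpa using interiorCoeff_one_add_lt h0 h1 hσ
  · rw [cC, if_neg (by omega), if_neg hpos.ne', if_neg hs.ne, aC_add_bC_sub_bC α σ hpos.ne']
    have h1s : (1 : ℝ) ≤ s := by exact_mod_cast hpos
    refine interiorCoeff_strictAntiOn h0 h1 ?_ ?_ ?_ <;>
      simp only [Set.mem_Ioi, Nat.succ_eq_add_one, Nat.cast_add, Nat.cast_one] <;> linarith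
end

section
/- Let α ∈ (0,1), σ = 1 - α/2, τ > 0, h > 0, and N ≥ 2 an integer. Let u^0, u^1, …, u^K be vectors in ℝ^{N-1}, equipped with the inner product (u,v) = h Σ_{i=1}^{N-1} u_i v_i and induced norm ‖·‖. Define δ_t̂ u^k = (1/(2τ)) [ (2σ+1) u^{k+1} - 4σ u^k + (2σ-1) u^{k-1} ] and E^{k+1} = (2σ+1)‖u^{k+1}‖² - (2σ-1)‖u^k‖² + (2σ²+σ-1)‖u^{k+1} - u^k‖². Then for every k with 1 ≤ k ≤ K-1, ( δ_t̂ u^k , σ u^{k+1} + (1-σ) u^k ) ≥ (1/(4τ)) ( E^{k+1} - E^k ). -/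
/-- Discrete squared norm `‖v‖² = h Σ_{i=1}^{N-1} v_i²` on `ℝ^{N-1}`. -/
noncomputable def nsq {n : ℕ} (h : ℝ) (v : Fin n → ℝ) : ℝ := h * ∑ i, (v i) ^ 2

/-- The energy
`E^{m} = (2σ+1)‖u^{m}‖² - (2σ-1)‖u^{m-1}‖² + (2σ²+σ-1)‖u^{m} - u^{m-1}‖²`. -/
noncomputable def Efun {n : ℕ} (σ h : ℝ) (u : ℕ → Fin n → ℝ) (m : ℕ) : ℝ :=
  (2 * σ + 1) * nsq h (u m) - (2 * σ - 1) * nsq h (u (m - 1))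
    + (2 * σ ^ 2 + σ - 1) * nsq h (fun i => u m i - u (m - 1) i)

/-- The gap in the drift energy inequality is a nonnegative multiple of the squared norm of the
second difference of `u`. -/
theorem drift_energy_identity {n : ℕ} (σ τ h : ℝ) (hτ : τ ≠ 0) (u : ℕ → Fin n → ℝ)
    (k : ℕ) :
    h * ∑ i, ((1 / (2 * τ)) *
          ((2 * σ + 1) * u (k + 1) i - 4 * σ * u k i + (2 * σ - 1) * u (k - 1) i)) *
        (σ * u (k + 1) i + (1 - σ) * u k i)
      = (1 / (4 * τ)) * (Efun σ h u (k + 1) - Efun σ h u k)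
        + (1 / (4 * τ)) * (σ * (2 * σ - 1)) *
          nsq h (fun i => u (k + 1) i - 2 * u k i + u (k - 1) i) := by
  simp only [Efun, nsq, Nat.add_sub_cancel, Finset.mul_sum, ← Finset.sum_add_distrib,
    ← Finset.sum_sub_distrib]
  refine Finset.sum_congr rfl fun i _ => ?_
  field_simp
  ring

/-- `(δ_t̂ u^k, σ u^{k+1} + (1-σ) u^k) ≥ (1/(4τ))(E^{k+1} - E^k)` for `1 ≤ k ≤ K-1`. -/
theorem drift_energy_inequality (α : ℝ) (hα : 0 < α ∧ α < 1) (σ : ℝ)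
    (hσ : σ = 1 - α / 2) (τ h : ℝ) (hτ : 0 < τ) (hh : 0 < h)
    (N : ℕ) (hN : 2 ≤ N) (K : ℕ) (u : ℕ → Fin (N - 1) → ℝ) :
    ∀ k : ℕ, 1 ≤ k → k ≤ K - 1 →
      h * ∑ i, ((1 / (2 * τ)) *
            ((2 * σ + 1) * u (k + 1) i - 4 * σ * u k i + (2 * σ - 1) * u (k - 1) i)) *
          (σ * u (k + 1) i + (1 - σ) * u k i)
        ≥ (1 / (4 * τ)) * (Efun σ h u (k + 1) - Efun σ h u k) := by
  intro k _ _
  rw [ge_iff_le, drift_energy_identity σ τ h hτ.ne' u k]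
  have hσ_pos : 0 ≤ σ := by linarith [hα.2]
  have hσ_half : 0 ≤ 2 * σ - 1 := by linarith [hα.2]
  refine le_add_of_nonneg_right ?_
  unfold nsq
  positivity
end

section
/- Let α ∈ (0,1), σ = 1 - α/2, h > 0, N ≥ 2 an integer, and let u^k, u^{k+1} be vectors in ℝ^{N-1} with the norm ‖u‖² = h Σ_{i=1}^{N-1} u_i². Then E^{k+1} = (2σ+1)‖u^{k+1}‖² - (2σ-1)‖u^k‖² + (2σ²+σ-1)‖u^{k+1} - u^k‖² satisfies E^{k+1} ≥ (1/σ) ‖u^{k+1}‖². -/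
theorem nsq_nonneg {n : ℕ} {h : ℝ} (hh : 0 ≤ h) (v : Fin n → ℝ) : 0 ≤ nsq h v :=
  mul_nonneg hh (Finset.sum_nonneg fun i _ => sq_nonneg (v i))

/-- The energy exceeds `(1/σ) ‖v‖²` by a multiple of a single squared norm. -/
theorem energy_sub_eq {n : ℕ} (h : ℝ) {σ : ℝ} (hσ : σ ≠ 0) (u v : Fin n → ℝ) :
    (2 * σ + 1) * nsq h v - (2 * σ - 1) * nsq h u
        + (2 * σ ^ 2 + σ - 1) * nsq h (fun i => v i - u i) - (1 / σ) * nsq h v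
      = (2 * σ - 1) / σ * nsq h (fun i => (σ + 1) * v i - σ * u i) := by
  simp only [nsq, Finset.mul_sum, ← Finset.sum_sub_distrib, ← Finset.sum_add_distrib]
  refine Finset.sum_congr rfl fun i _ => ?_
  field_simp
  ring

/-- The energy `E^{k+1}` satisfies `E^{k+1} ≥ (1/σ) ‖u^{k+1}‖²`. -/
theorem energy_lower_bound (α : ℝ) (hα : 0 < α ∧ α < 1) (σ : ℝ)
    (hσ : σ = 1 - α / 2) (h : ℝ) (hh : 0 < h) (N : ℕ) (hN : 2 ≤ N)
    (uk uk1 : Fin (N - 1) → ℝ) :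
    (2 * σ + 1) * nsq h uk1 - (2 * σ - 1) * nsq h uk
        + (2 * σ ^ 2 + σ - 1) * nsq h (fun i => uk1 i - uk i)
      ≥ (1 / σ) * nsq h uk1 := by
  have hσ_half : 1 / 2 < σ := by linarith [hα.2]
  have hσ_pos : 0 < σ := by linarith
  rw [ge_iff_le, ← sub_nonneg, energy_sub_eq h hσ_pos.ne']
  exact mul_nonneg (div_nonneg (by linarith) hσ_pos.le) (nsq_nonneg hh.le _)
end

section
/- Consider the implicit L2-1_σ difference scheme for the 1D time fractional reaction-diffusion equation with homogeneous boundary conditions. Then the first time level satisfies the a priori estimate ‖u^1‖² ≤ ( 4 σ^{α} T^{1-α} / Γ(2-α) + 2σ ) ‖u^0‖² + 4 σ^{α} T^{1+α} Γ(2-α) ‖f^{σ}‖², where ‖f^{σ}‖² = h Σ_{i=1}^{N-1} f(x_i, στ)². -/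
/-- Drift approximation `δ_t̂ v^j = (1/(2τ))[(2σ+1)v^{j+1} - 4σ v^j + (2σ-1)v^{j-1}]`
(natural subtraction realizes the convention `v^{-1} = v^0`). -/
noncomputable def driftD (σ τ : ℝ) (v : ℕ → ℝ) (j : ℕ) : ℝ :=
  (1 / (2 * τ)) * ((2 * σ + 1) * v (j + 1) - 4 * σ * v j + (2 * σ - 1) * v (j - 1))

/-- Discrete Caputo (L2-1_σ) operator
`Δ^α v^j = (τ^{-α}/Γ(2-α)) Σ_{s=0}^{j} c_{j-s}^{(α,σ)}(v^{s+1} - v^s)`. -/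
noncomputable def fracD (α σ τ : ℝ) (v : ℕ → ℝ) (j : ℕ) : ℝ :=
  (τ ^ (-α) / Real.Gamma (2 - α)) *
    ∑ s ∈ Finset.range (j + 1), cC α σ j (j - s) * (v (s + 1) - v s)

/-- 1D discrete variable-coefficient diffusion-reaction operator
`(Λ v)_i = h^{-2}[k(x_i+h/2,t)(v_{i+1}-v_i) - k(x_i-h/2,t)(v_i-v_{i-1})] - q(x_i,t)v_i`. -/
noncomputable def lam1D (k q : ℝ → ℝ → ℝ) (h t : ℝ) (v : ℕ → ℝ) (i : ℕ) : ℝ :=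
  (1 / h ^ 2) * (k ((i : ℝ) * h + h / 2) t * (v (i + 1) - v i)
      - k ((i : ℝ) * h - h / 2) t * (v i - v (i - 1)))
    - q ((i : ℝ) * h) t * v i

/-- Discrete squared `L₂` norm `‖v‖² = h Σ_{i=1}^{N-1} v_i²`. -/
noncomputable def nrm2 (h : ℝ) (N : ℕ) (v : ℕ → ℝ) : ℝ :=
  h * ∑ i ∈ Finset.Icc 1 (N - 1), (v i) ^ 2

/-- Discrete summation by parts. -/
theorem sum_divergence_mul_eq (κ w : ℕ → ℝ) (n : ℕ) :
    ∑ i ∈ Finset.Icc 1 n, (κ i * (w (i + 1) - w i) - κ (i - 1) * (w i - w (i - 1))) * w i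
      = -(∑ i ∈ Finset.range n, κ i * (w (i + 1) - w i) ^ 2)
        + κ n * (w (n + 1) - w n) * w n - κ 0 * (w 1 - w 0) * w 0 := by
  induction n with
  | zero => simp
  | succ n ih =>
    rw [Finset.sum_Icc_succ_top (by omega), ih, Finset.sum_range_succ, Nat.add_sub_cancel]
    ring

/-- With homogeneous boundary values, the discrete divergence-form operator is dissipative. -/
theorem sum_divergence_mul_nonpos {κ w : ℕ → ℝ} {n : ℕ} (hκ : ∀ i ≤ n, 0 ≤ κ i)
    (h0 : w 0 = 0) (hn : w (n + 1) = 0) :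
    ∑ i ∈ Finset.Icc 1 n,
      (κ i * (w (i + 1) - w i) - κ (i - 1) * (w i - w (i - 1))) * w i ≤ 0 := by
  rw [sum_divergence_mul_eq, h0, hn]
  have hs : 0 ≤ ∑ i ∈ Finset.range n, κ i * (w (i + 1) - w i) ^ 2 :=
    Finset.sum_nonneg fun i hi =>
      mul_nonneg (hκ i (Finset.mem_range.1 hi).le) (sq_nonneg _)
  have hb := mul_nonneg (hκ n le_rfl) (sq_nonneg (w n))
  nlinarith

/-- The operator `lam1D` is negative semidefinite on grid functions vanishing at the ends. -/
theorem sum_lam1D_mul_nonpos {k q : ℝ → ℝ → ℝ} {h t : ℝ} {w : ℕ → ℝ} {n : ℕ}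
    (hk : ∀ i : ℕ, i ≤ n → 0 ≤ k (i * h + h / 2) t)
    (hq : ∀ i : ℕ, i ≤ n → 0 ≤ q (i * h) t) (h0 : w 0 = 0) (hn : w (n + 1) = 0) :
    ∑ i ∈ Finset.Icc 1 n, lam1D k q h t w i * w i ≤ 0 := by
  have hdiv := sum_divergence_mul_nonpos (κ := fun i : ℕ => k (i * h + h / 2) t) hk h0 hn
  have hsplit : ∑ i ∈ Finset.Icc 1 n, lam1D k q h t w i * w i
      = (1 / h ^ 2) * (∑ i ∈ Finset.Icc 1 n,
          (k (i * h + h / 2) t * (w (i + 1) - w i)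
            - k (((i - 1 : ℕ) : ℝ) * h + h / 2) t * (w i - w (i - 1))) * w i)
        - ∑ i ∈ Finset.Icc 1 n, q (i * h) t * w i ^ 2 := by
    rw [Finset.mul_sum, ← Finset.sum_sub_distrib]
    refine Finset.sum_congr rfl fun i hi => ?_
    have hmid : ((i - 1 : ℕ) : ℝ) * h + h / 2 = i * h - h / 2 := by
      rw [Nat.cast_sub (Finset.mem_Icc.1 hi).1]
      push_cast
      ring
    rw [hmid, lam1D]
    ring
  have hqs : 0 ≤ ∑ i ∈ Finset.Icc 1 n, q (i * h) t * w i ^ 2 :=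
    Finset.sum_nonneg fun i hi => mul_nonneg (hq i (Finset.mem_Icc.1 hi).2) (sq_nonneg _)
  have hh : 0 ≤ 1 / h ^ 2 := by positivity
  rw [hsplit]
  nlinarith [mul_nonpos_of_nonneg_of_nonpos hh hdiv]

/-- `lam1D` is linear in the grid function. -/
theorem lam1D_combination (k q : ℝ → ℝ → ℝ) (h t a b : ℝ) (v w : ℕ → ℝ) (i : ℕ) :
    lam1D k q h t (fun m => a * v m + b * w m) i
      = a * lam1D k q h t v i + b * lam1D k q h t w i := by
  simp only [lam1D]
  ring

/-- Pointwise quadratic inequality behind the one-step energy estimate. -/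
theorem sq_add_le_weighted {σ ε : ℝ} (hσ : 1 / 2 ≤ σ) (hε : 0 < ε) (x d p : ℝ) :
    (x + d) ^ 2 ≤ (1 + ε) * x ^ 2 + (1 + 1 / ε) * p ^ 2
      + 2 * (1 + ε) / (1 + σ * ε) * ((d - p) * (x + σ * d)) := by
  have hσε : 0 < σ * ε := by positivity
  have hden : 0 < 1 + σ * ε := by linarith
  set y := d - ε * x with hy
  set z := p - ε * x with hz
  have hd : d = ε * x + y := by rw [hy]; ring
  have hp : p = ε * x + z := by rw [hz]; ring
  have hc : 0 < 2 * σ - 1 + σ * ε := by linarith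
  have hquad : 0 ≤ (2 * σ - 1 + σ * ε) * y ^ 2 - 2 * σ * (1 + ε) * (y * z)
      + (1 + 1 / ε) * (1 + σ * ε) * z ^ 2 := by
    have hdisc : 0 ≤ (2 * σ - 1 + σ * ε) * ((1 + 1 / ε) * (1 + σ * ε))
        - (σ * (1 + ε)) ^ 2 := by
      have : (2 * σ - 1 + σ * ε) * ((1 + 1 / ε) * (1 + σ * ε)) - (σ * (1 + ε)) ^ 2
          = (1 + ε) / ε * (2 * σ - 1 + σ ^ 2 * ε) := by
        field_simp
        ring
      rw [this]
      have : 0 ≤ 2 * σ - 1 + σ ^ 2 * ε := by nlinarith [mul_nonneg (sq_nonneg σ) hε.le]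
      positivity
    refine nonneg_of_mul_nonneg_right ?_ hc
    nlinarith [sq_nonneg ((2 * σ - 1 + σ * ε) * y - σ * (1 + ε) * z),
      mul_nonneg hdisc (sq_nonneg z)]
  have hid : (1 + ε) * x ^ 2 + (1 + 1 / ε) * p ^ 2
      + 2 * (1 + ε) / (1 + σ * ε) * ((d - p) * (x + σ * d)) - (x + d) ^ 2
      = ((2 * σ - 1 + σ * ε) * y ^ 2 - 2 * σ * (1 + ε) * (y * z)
      + (1 + 1 / ε) * (1 + σ * ε) * z ^ 2) / (1 + σ * ε) := by
    rw [hd, hp]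
    field_simp
    ring
  have := div_nonneg hquad hden.le
  linarith

/-- Energy estimate for one step of `A (u₁ - u₀) = g + F`, when `g` is dissipative against
`σ u₁ + (1 - σ) u₀`. -/
theorem sum_sq_step_le {ι : Type*} (s : Finset ι) {σ ε A : ℝ} (hσ : 1 / 2 ≤ σ) (hε : 0 < ε)
    (hA : 0 < A) (u₀ u₁ g F : ι → ℝ) (heq : ∀ i ∈ s, A * (u₁ i - u₀ i) = g i + F i)
    (hg : ∑ i ∈ s, g i * (σ * u₁ i + (1 - σ) * u₀ i) ≤ 0) :
    ∑ i ∈ s, u₁ i ^ 2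
      ≤ (1 + ε) * ∑ i ∈ s, u₀ i ^ 2 + (1 + 1 / ε) / A ^ 2 * ∑ i ∈ s, F i ^ 2 := by
  have hpt : ∀ i ∈ s, u₁ i ^ 2 ≤ (1 + ε) * u₀ i ^ 2 + (1 + 1 / ε) / A ^ 2 * F i ^ 2
      + 2 * (1 + ε) / (1 + σ * ε) / A * (g i * (σ * u₁ i + (1 - σ) * u₀ i)) := by
    intro i hi
    have hdp : u₁ i - u₀ i - F i / A = g i / A := by
      field_simp
      linarith [heq i hi]
    have := sq_add_le_weighted hσ hε (u₀ i) (u₁ i - u₀ i) (F i / A)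
    rw [hdp] at this
    calc u₁ i ^ 2 = (u₀ i + (u₁ i - u₀ i)) ^ 2 := by ring
      _ ≤ _ := this
      _ = _ := by ring
  refine (Finset.sum_le_sum hpt).trans ?_
  rw [Finset.sum_add_distrib, Finset.sum_add_distrib, ← Finset.mul_sum, ← Finset.mul_sum,
    ← Finset.mul_sum]
  have hc : 0 ≤ 2 * (1 + ε) / (1 + σ * ε) / A := by positivity
  linarith [mul_nonpos_of_nonneg_of_nonpos hc hg]

/-- The forcing coefficient produced by the energy estimate is bounded uniformly in the step. -/
theorem forcing_coefficient_le {α σ τ T Γ : ℝ} (hα : 0 < α) (hα1 : α < 1) (hσ : 1 / 2 ≤ σ)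
    (hσ1 : σ ≤ 1) (hτ : 0 < τ) (hτT : τ ≤ T) (hΓ : 0 < Γ) :
    (1 + 1 / (2 * σ - 1 + 4 * σ ^ α * T ^ (1 - α) / Γ))
        / ((2 * σ + 1) / (2 * τ) + τ ^ (-α) / Γ * σ ^ (1 - α)) ^ 2
      ≤ 4 * σ ^ α * T ^ (1 + α) * Γ := by
  have hT : 0 < T := hτ.trans_le hτT
  have hσ0 : 0 < σ := by linarith
  have hX : 0 < T ^ (1 - α) := Real.rpow_pos_of_pos hT _
  have hr : 1 / 2 ≤ σ ^ α := by
    have := Real.rpow_le_rpow_of_exponent_ge hσ0 hσ1 hα1.le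
    rw [Real.rpow_one] at this
    linarith
  have hr0 : 0 < σ ^ α := by linarith
  have hσr : σ ^ (1 - α) = σ / σ ^ α := by rw [Real.rpow_sub hσ0, Real.rpow_one]
  have hTα : T * T ^ (-α) = T ^ (1 - α) := by
    rw [sub_eq_add_neg, Real.rpow_add hT, Real.rpow_one]
  have hTsq : T ^ 2 = T ^ (1 + α) * T ^ (1 - α) := by
    rw [← Real.rpow_add hT, ← Real.rpow_natCast]
    norm_num
  have hTp : 0 < T ^ (1 + α) := Real.rpow_pos_of_pos hT _
  have hττ : T ^ (-α) ≤ τ ^ (-α) :=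
    Real.rpow_le_rpow_of_nonpos hτ hτT (by linarith)
  set r := σ ^ α
  set X := T ^ (1 - α)
  set A := (2 * σ + 1) / (2 * τ) + τ ^ (-α) / Γ * σ ^ (1 - α) with hA
  set y := r * X / Γ with hy
  have hy0 : 0 < y := by positivity
  have hXy : X = y * Γ / r := by rw [hy]; field_simp
  have hAT : 1 + y / (2 * r ^ 2) ≤ T * A := by
    have hdrift : 1 ≤ T * ((2 * σ + 1) / (2 * τ)) := by
      rw [← mul_div_assoc, le_div_iff₀ (by positivity)]
      nlinarith
    have hmem : y / (2 * r ^ 2) ≤ T * (τ ^ (-α) / Γ * σ ^ (1 - α)) := by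
      calc y / (2 * r ^ 2) = 1 / 2 * (X / (Γ * r)) := by rw [hy]; field_simp
        _ ≤ σ * (X / (Γ * r)) := by gcongr
        _ = T * (T ^ (-α) / Γ * σ ^ (1 - α)) := by rw [← hTα, hσr]; field_simp
        _ ≤ _ := by gcongr
    rw [hA, mul_add]
    linarith
  have hA0 : 0 < A := by
    have : 0 < T * A := lt_of_lt_of_le (by positivity) hAT
    exact pos_of_mul_pos_right this hT.le
  have hεy : 4 * r * X / Γ = 4 * y := by rw [hy]; ring
  have hinv : 1 / (2 * σ - 1 + 4 * r * X / Γ) ≤ 1 / (4 * y) := by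
    rw [hεy]
    exact one_div_le_one_div_of_le (by positivity) (by linarith)
  have hbase : y * (1 + 1 / (4 * y)) ≤ 4 * r ^ 2 * (T * A) ^ 2 := by
    have hsq : (1 + y / (2 * r ^ 2)) ^ 2 ≤ (T * A) ^ 2 := by gcongr
    have hexp : 4 * r ^ 2 * (1 + y / (2 * r ^ 2)) ^ 2 = 4 * r ^ 2 + 4 * y + y ^ 2 / r ^ 2 := by
      field_simp
      ring
    have hlow : y * (1 + 1 / (4 * y)) = y + 1 / 4 := by field_simp
    have hyr : 0 ≤ y ^ 2 / r ^ 2 := by positivity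
    nlinarith [mul_le_mul_of_nonneg_left hsq (by positivity : 0 ≤ 4 * r ^ 2)]
  have hstep : 1 + 1 / (4 * y) ≤ 4 * r * T ^ (1 + α) * Γ * A ^ 2 := by
    refine le_of_mul_le_mul_left (hbase.trans_eq ?_) hy0
    rw [mul_pow, hTsq, hXy]
    field_simp
  rw [div_le_iff₀ (by positivity)]
  linarith

/-- A priori estimate for the first time level of the implicit L2-1_σ scheme
for the 1D time fractional reaction-diffusion equation (homogeneous BCs). -/
theorem first_level_estimate_1D (α : ℝ) (hα : 0 < α ∧ α < 1) (σ : ℝ)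
    (hσ : σ = 1 - α / 2) (L T : ℝ) (hL : 0 < L) (hT : 0 < T)
    (N M : ℕ) (hN : 2 ≤ N) (hM : 1 ≤ M) (h τ : ℝ) (hh : h = L / N) (hτ : τ = T / M)
    (k q f : ℝ → ℝ → ℝ) (C₀ : ℝ) (hC₀ : 0 < C₀)
    (hk : ∀ x ∈ Set.Icc 0 L, ∀ t ∈ Set.Icc 0 T, C₀ ≤ k x t)
    (hq : ∀ x ∈ Set.Icc 0 L, ∀ t ∈ Set.Icc 0 T, 0 ≤ q x t)
    (u : ℕ → ℕ → ℝ)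
    (hbd : ∀ j, j ≤ M → u j 0 = 0 ∧ u j N = 0)
    (hscheme : ∀ j < M, ∀ i, 1 ≤ i → i ≤ N - 1 →
      driftD σ τ (fun m => u m i) j + fracD α σ τ (fun m => u m i) j
        = σ * lam1D k q h (((j : ℝ) + σ) * τ) (u (j + 1)) i
          + (1 - σ) * lam1D k q h (((j : ℝ) + σ) * τ) (u j) i
          + f ((i : ℝ) * h) (((j : ℝ) + σ) * τ)) :
    nrm2 h N (u 1)
      ≤ (4 * σ ^ α * T ^ (1 - α) / Real.Gamma (2 - α) + 2 * σ) * nrm2 h N (u 0)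
        + 4 * σ ^ α * T ^ (1 + α) * Real.Gamma (2 - α) *
            (h * ∑ i ∈ Finset.Icc 1 (N - 1), (f ((i : ℝ) * h) (σ * τ)) ^ 2) := by
  obtain ⟨hα0, hα1⟩ := hα
  have hσ2 : 1 / 2 ≤ σ := by linarith
  have hσ1 : σ ≤ 1 := by linarith
  have hM1 : (1 : ℝ) ≤ M := by exact_mod_cast hM
  have hτ0 : 0 < τ := by rw [hτ]; positivity
  have hτT : τ ≤ T := by rw [hτ]; exact div_le_self hT.le hM1
  have hΓ : 0 < Real.Gamma (2 - α) := Real.Gamma_pos_of_pos (by linarith)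
  obtain ⟨n, rfl⟩ : ∃ n, N = n + 1 := ⟨N - 1, by omega⟩
  simp only [Nat.add_sub_cancel, nrm2] at hscheme ⊢
  have hh0 : 0 < h := by rw [hh]; positivity
  have hLh : ((n : ℝ) + 1) * h = L := by
    rw [hh]
    push_cast
    field_simp
  have ht : σ * τ ∈ Set.Icc 0 T := ⟨by positivity, by nlinarith⟩
  have hin : ∀ i : ℕ, i ≤ n → (i : ℝ) * h + h ≤ L := fun i hi => by
    have : (i : ℝ) ≤ n := by exact_mod_cast hi
    nlinarith
  have hdiss := sum_lam1D_mul_nonpos (k := k) (q := q) (h := h) (t := σ * τ)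
    (w := fun m => σ * u 1 m + (1 - σ) * u 0 m) (n := n)
    (fun i hi => hC₀.le.trans
      (hk _ ⟨by positivity, by linarith [hin i hi]⟩ _ ht))
    (fun i hi => hq _ ⟨by positivity, by linarith [hin i hi]⟩ _ ht)
    (by simp [(hbd 0 (by omega)).1, (hbd 1 hM).1])
    (by simp [(hbd 0 (by omega)).2, (hbd 1 hM).2])
  have hε : 0 < 2 * σ - 1 + 4 * σ ^ α * T ^ (1 - α) / Real.Gamma (2 - α) := by
    have : 0 < 4 * σ ^ α * T ^ (1 - α) / Real.Gamma (2 - α) := by positivity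
    linarith
  have hmain := sum_sq_step_le (Finset.Icc 1 n) hσ2 hε
    (A := (2 * σ + 1) / (2 * τ) + τ ^ (-α) / Real.Gamma (2 - α) * σ ^ (1 - α))
    (by positivity) (u 0) (u 1) _ (fun i => f (i * h) (σ * τ))
    (fun i hi => by
      have hs := hscheme 0 hM i (Finset.mem_Icc.1 hi).1 (Finset.mem_Icc.1 hi).2
      simp only [driftD, fracD, cC, aC, zero_add, Nat.cast_zero, Finset.sum_range_one,
        if_true, Nat.zero_sub] at hs
      rw [lam1D_combination, ← hs]
      ring) hdiss
  have hF := mul_le_mul_of_nonneg_right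
    (forcing_coefficient_le hα0 hα1 hσ2 hσ1 hτ0 hτT hΓ)
    (Finset.sum_nonneg fun i (_ : i ∈ Finset.Icc 1 n) => sq_nonneg (f (i * h) (σ * τ)))
  have := mul_le_mul_of_nonneg_left (hmain.trans (add_le_add_right hF _)) hh0.le
  refine this.trans_eq ?_
  ring
end

section
/- Consider the implicit L2-1_σ difference scheme for the 2D time fractional reaction-diffusion equation with homogeneous boundary conditions. Then the first time level satisfies the a priori estimate ‖U^1‖²_{2D} ≤ ( 4 T^{1-α} σ^{α} / Γ(2-α) + 2σ ) ‖U^0‖²_{2D} + 4 σ^{α} T^{1+α} Γ(2-α) ‖f^{σ}‖²_{2D}, where ‖f^{σ}‖²_{2D} = h_x h_y Σ_{i=1}^{N_x - 1} Σ_{l=1}^{N_y - 1} f(x_i, y_l, στ)². -/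
/-- 2D discrete variable-coefficient diffusion-reaction operator `Λ̃` at time `t`. -/
noncomputable def lam2D (d k q : ℝ → ℝ → ℝ → ℝ) (hx hy t : ℝ)
    (V : ℕ → ℕ → ℝ) (i l : ℕ) : ℝ :=
  (1 / hx ^ 2) * (d ((i : ℝ) * hx + hx / 2) ((l : ℝ) * hy) t * (V (i + 1) l - V i l)
      - d ((i : ℝ) * hx - hx / 2) ((l : ℝ) * hy) t * (V i l - V (i - 1) l))
    + (1 / hy ^ 2) * (k ((i : ℝ) * hx) ((l : ℝ) * hy + hy / 2) t * (V i (l + 1) - V i l)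
      - k ((i : ℝ) * hx) ((l : ℝ) * hy - hy / 2) t * (V i l - V i (l - 1)))
    - q ((i : ℝ) * hx) ((l : ℝ) * hy) t * V i l

/-- 2D discrete squared `L₂` norm
`‖V‖²_{2D} = hx hy Σ_{i=1}^{Nx-1} Σ_{l=1}^{Ny-1} V_{il}²`. -/
noncomputable def nrm2D (hx hy : ℝ) (Nx Ny : ℕ) (V : ℕ → ℕ → ℝ) : ℝ :=
  hx * hy * ∑ i ∈ Finset.Icc 1 (Nx - 1), ∑ l ∈ Finset.Icc 1 (Ny - 1), (V i l) ^ 2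

/-- Summation by parts: a flux-form difference operator with nonnegative coefficients is
dissipative on grid functions vanishing at both ends. -/
lemma sum_flux_mul_nonpos (N : ℕ) (p m W : ℕ → ℝ) (hp : ∀ i < N, 0 ≤ p i)
    (hm : ∀ i, m (i + 1) = p i) (h0 : W 0 = 0) (hN : W N = 0) :
    ∑ i ∈ Finset.Icc 1 (N - 1),
      (p i * (W (i + 1) - W i) - m i * (W i - W (i - 1))) * W i ≤ 0 := by
  have key : ∀ n, n < N → ∑ i ∈ Finset.Icc 1 n,
      (p i * (W (i + 1) - W i) - m i * (W i - W (i - 1))) * W i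
        ≤ p n * (W (n + 1) - W n) * W n := by
    intro n
    induction n with
    | zero => intro _; simp [h0]
    | succ n ih =>
      intro hn
      rw [Finset.sum_Icc_succ_top (by omega), hm]
      have h1 := ih (by omega)
      have h2 := mul_nonneg (hp n (by omega)) (sq_nonneg (W (n + 1) - W n))
      simp only [Nat.add_sub_cancel]
      nlinarith
  rcases N.eq_zero_or_pos with rfl | hpos
  · simp
  · have h1 := key (N - 1) (by omega)
    have h2 := mul_nonneg (hp (N - 1) (by omega)) (sq_nonneg (W (N - 1)))
    rw [Nat.sub_add_cancel hpos, hN] at h1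
    nlinarith

/-- A weighted form of `x² ≤ (|y| + |g|)²` adapted to the inner product of the scheme with
`σ x + (1 - σ) y`. -/
lemma sq_le_weighted_step {σ ε : ℝ} (h1 : 1 / 2 ≤ σ) (h2 : σ ≤ 1) (hε : 0 < ε) (x y g : ℝ) :
    x ^ 2 ≤ (1 + ε) * y ^ 2 + (1 + 1 / ε) * g ^ 2
      + 2 * (1 + ε) / (1 + σ * ε) * ((x - y - g) * (σ * x + (1 - σ) * y)) := by
  have hD : 0 < 1 + σ * ε := by nlinarith
  have hσε : 0 < σ * ε := by positivity
  have hsum : 0 ≤ (ε * (x - y - g) * (1 - σ) + (ε * y - g)) ^ 2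
      + ε * (x - y - g) ^ 2 * ((2 * σ - 1 + σ * ε) - ε * (1 - σ) ^ 2)
      + σ * ε * ((ε * y - g) ^ 2) := by
    have : 0 ≤ (2 * σ - 1 + σ * ε) - ε * (1 - σ) ^ 2 := by nlinarith
    positivity
  have heq : (1 + ε) * y ^ 2 + (1 + 1 / ε) * g ^ 2
      + 2 * (1 + ε) / (1 + σ * ε) * ((x - y - g) * (σ * x + (1 - σ) * y)) - x ^ 2
      = ((ε * (x - y - g) * (1 - σ) + (ε * y - g)) ^ 2
      + ε * (x - y - g) ^ 2 * ((2 * σ - 1 + σ * ε) - ε * (1 - σ) ^ 2)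
      + σ * ε * ((ε * y - g) ^ 2)) / (ε * (1 + σ * ε)) := by
    field_simp
    ring
  have := div_nonneg hsum (by positivity : 0 ≤ ε * (1 + σ * ε))
  linarith

/-- The diffusion-reaction operator is dissipative for grid functions vanishing on the
boundary. -/
lemma sum_lam2D_mul_nonpos (d k q : ℝ → ℝ → ℝ → ℝ) (hx hy t : ℝ) (Nx Ny : ℕ)
    (V : ℕ → ℕ → ℝ)
    (hd : ∀ i < Nx, ∀ l ∈ Finset.Icc 1 (Ny - 1),
      0 ≤ d ((i : ℝ) * hx + hx / 2) ((l : ℝ) * hy) t)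
    (hk : ∀ i ∈ Finset.Icc 1 (Nx - 1), ∀ l < Ny,
      0 ≤ k ((i : ℝ) * hx) ((l : ℝ) * hy + hy / 2) t)
    (hq : ∀ i ∈ Finset.Icc 1 (Nx - 1), ∀ l ∈ Finset.Icc 1 (Ny - 1),
      0 ≤ q ((i : ℝ) * hx) ((l : ℝ) * hy) t)
    (hbx : ∀ l, V 0 l = 0 ∧ V Nx l = 0) (hby : ∀ i, V i 0 = 0 ∧ V i Ny = 0) :
    ∑ i ∈ Finset.Icc 1 (Nx - 1), ∑ l ∈ Finset.Icc 1 (Ny - 1),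
      lam2D d k q hx hy t V i l * V i l ≤ 0 := by
  have hX : ∑ i ∈ Finset.Icc 1 (Nx - 1), ∑ l ∈ Finset.Icc 1 (Ny - 1),
      (d ((i : ℝ) * hx + hx / 2) ((l : ℝ) * hy) t * (V (i + 1) l - V i l)
        - d ((i : ℝ) * hx - hx / 2) ((l : ℝ) * hy) t * (V i l - V (i - 1) l)) * V i l ≤ 0 := by
    rw [Finset.sum_comm]
    refine Finset.sum_nonpos fun l hl => ?_
    refine sum_flux_mul_nonpos Nx (fun i => d ((i : ℝ) * hx + hx / 2) ((l : ℝ) * hy) t)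
      (fun i => d ((i : ℝ) * hx - hx / 2) ((l : ℝ) * hy) t) (fun i => V i l)
      (fun i hi => hd i hi l hl) (fun i => ?_) (hbx l).1 (hbx l).2
    congr 1
    push_cast
    ring
  have hY : ∑ i ∈ Finset.Icc 1 (Nx - 1), ∑ l ∈ Finset.Icc 1 (Ny - 1),
      (k ((i : ℝ) * hx) ((l : ℝ) * hy + hy / 2) t * (V i (l + 1) - V i l)
        - k ((i : ℝ) * hx) ((l : ℝ) * hy - hy / 2) t * (V i l - V i (l - 1))) * V i l ≤ 0 := by
    refine Finset.sum_nonpos fun i hi => ?_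
    refine sum_flux_mul_nonpos Ny (fun l => k ((i : ℝ) * hx) ((l : ℝ) * hy + hy / 2) t)
      (fun l => k ((i : ℝ) * hx) ((l : ℝ) * hy - hy / 2) t) (fun l => V i l)
      (fun l hl => hk i hi l hl) (fun l => ?_) (hby i).1 (hby i).2
    congr 1
    push_cast
    ring
  have hQ : 0 ≤ ∑ i ∈ Finset.Icc 1 (Nx - 1), ∑ l ∈ Finset.Icc 1 (Ny - 1),
      q ((i : ℝ) * hx) ((l : ℝ) * hy) t * (V i l) ^ 2 :=
    Finset.sum_nonneg fun i hi => Finset.sum_nonneg fun l hl =>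
      mul_nonneg (hq i hi l hl) (sq_nonneg _)
  have hx2 : 0 ≤ 1 / hx ^ 2 := by positivity
  have hy2 : 0 ≤ 1 / hy ^ 2 := by positivity
  refine le_of_eq_of_le ?_ ((sub_le_self _ hQ).trans
    (add_nonpos (mul_nonpos_of_nonneg_of_nonpos hx2 hX)
      (mul_nonpos_of_nonneg_of_nonpos hy2 hY)))
  simp only [Finset.mul_sum, ← Finset.sum_add_distrib, ← Finset.sum_sub_distrib]
  refine Finset.sum_congr rfl fun i _ => Finset.sum_congr rfl fun l _ => ?_
  simp only [lam2D]
  ring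

lemma lam2D_linear_comb (d k q : ℝ → ℝ → ℝ → ℝ) (hx hy t a b : ℝ) (V W : ℕ → ℕ → ℝ)
    (i l : ℕ) :
    a * lam2D d k q hx hy t V i l + b * lam2D d k q hx hy t W i l
      = lam2D d k q hx hy t (fun i l => a * V i l + b * W i l) i l := by
  simp only [lam2D]
  ring

/-- The leading coefficient of the first step of the scheme controls the constant in front of
the source term. -/
lemma source_constant_le {α σ τ T G : ℝ} (hα₀ : 0 < α) (hα₁ : α < 1) (hσ : σ = 1 - α / 2)
    (hτ : 0 < τ) (hτT : τ ≤ T) (hG : 0 < G) :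
    1 + 1 / (4 * T ^ (1 - α) * σ ^ α / G + (2 * σ - 1))
      ≤ 4 * σ ^ α * T ^ (1 + α) * G *
        ((2 * σ + 1) / (2 * τ) + τ ^ (-α) * σ ^ (1 - α) / G) ^ 2 := by
  have hT : 0 < T := hτ.trans_le hτT
  have hσ₀ : 1 / 2 < σ := by linarith
  have hσp : 0 < σ := by linarith
  have hs : 1 / 2 < σ ^ α := by
    have := Real.rpow_le_rpow_of_exponent_ge hσp (by linarith) hα₁.le
    rw [Real.rpow_one] at this
    linarith
  have hrs : σ ^ (1 - α) * σ ^ α = σ := by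
    rw [← Real.rpow_add hσp]; simp
  have hT2 : T ^ (1 + α) * T ^ (1 - α) = T ^ 2 := by
    rw [← Real.rpow_add hT, ← Real.rpow_natCast]; norm_num
  have hTn : T ^ (-α) = T ^ (1 - α) / T := by
    rw [eq_div_iff hT.ne', ← Real.rpow_add_one hT.ne']
    congr 1
    ring
  have hτn : T ^ (-α) ≤ τ ^ (-α) := Real.rpow_le_rpow_of_nonpos hτ hτT (by linarith)
  have hr : 0 < σ ^ (1 - α) := by positivity
  have hu : 0 < T ^ (1 - α) := by positivity
  have hv : 0 < T ^ (1 + α) := by positivity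
  have hA : (2 * σ + 1) / (2 * T) + T ^ (-α) * σ ^ (1 - α) / G
      ≤ (2 * σ + 1) / (2 * τ) + τ ^ (-α) * σ ^ (1 - α) / G := by gcongr
  rw [hTn] at hA
  set s := σ ^ α
  set r := σ ^ (1 - α)
  set u := T ^ (1 - α)
  set v := T ^ (1 + α)
  have hv' : v = T ^ 2 / u := by rw [eq_div_iff hu.ne', hT2]
  have hε : 1 / (4 * u * s / G + (2 * σ - 1)) ≤ G / (4 * u * s) := by
    rw [← one_div_div (4 * u * s) G]
    apply one_div_le_one_div_of_le (by positivity)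
    linarith
  calc 1 + 1 / (4 * u * s / G + (2 * σ - 1)) ≤ 1 + G / (4 * u * s) := by linarith
    _ ≤ 8 * (σ + 1 / 2) * (r * s) + 4 * s * G * (σ + 1 / 2) ^ 2 / u := by
        rw [hrs]
        have h1 : G / (4 * u * s) ≤ 4 * s * G * (σ + 1 / 2) ^ 2 / u := by
          rw [div_le_div_iff₀ (by positivity) hu]
          have h3 : 1 ≤ 16 * s ^ 2 * (σ + 1 / 2) ^ 2 := by
            have h4 : 1 ≤ 4 * s * (σ + 1 / 2) := by nlinarith
            nlinarith
          nlinarith [mul_le_mul_of_nonneg_left h3 (mul_pos hG hu).le]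
        nlinarith
    _ ≤ 4 * s * v * G * ((2 * σ + 1) / (2 * T) + u / T * r / G) ^ 2 := by
        have h5 : 4 * s * v * G * ((2 * σ + 1) / (2 * T) + u / T * r / G) ^ 2
            = 8 * (σ + 1 / 2) * (r * s) + 4 * s * G * (σ + 1 / 2) ^ 2 / u
              + 4 * s * u * r ^ 2 / G := by
          rw [hv']
          field_simp
          ring
        rw [h5]
        have : 0 ≤ 4 * s * u * r ^ 2 / G := by positivity
        linarith
    _ ≤ _ := by gcongr

/-- A priori estimate for the first time level of the implicit L2-1_σ scheme
for the 2D time fractional reaction-diffusion equation (homogeneous BCs). -/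
theorem first_level_estimate_2D (α : ℝ) (hα : 0 < α ∧ α < 1) (σ : ℝ)
    (hσ : σ = 1 - α / 2) (Lx Ly T : ℝ) (hLx : 0 < Lx) (hLy : 0 < Ly) (hT : 0 < T)
    (Nx Ny M : ℕ) (hNx : 2 ≤ Nx) (hNy : 2 ≤ Ny) (hM : 1 ≤ M)
    (hx hy τ : ℝ) (hhx : hx = Lx / Nx) (hhy : hy = Ly / Ny) (hτ : τ = T / M)
    (d k q f : ℝ → ℝ → ℝ → ℝ) (C₃ C₄ : ℝ) (hC₃ : 0 < C₃) (hC₄ : 0 < C₄)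
    (hd : ∀ x ∈ Set.Icc 0 Lx, ∀ y ∈ Set.Icc 0 Ly, ∀ t ∈ Set.Icc 0 T, C₃ ≤ d x y t)
    (hk : ∀ x ∈ Set.Icc 0 Lx, ∀ y ∈ Set.Icc 0 Ly, ∀ t ∈ Set.Icc 0 T, C₄ ≤ k x y t)
    (hq : ∀ x ∈ Set.Icc 0 Lx, ∀ y ∈ Set.Icc 0 Ly, ∀ t ∈ Set.Icc 0 T, 0 ≤ q x y t)
    (U : ℕ → ℕ → ℕ → ℝ)
    (hbx : ∀ j, j ≤ M → ∀ l, U j 0 l = 0 ∧ U j Nx l = 0)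
    (hby : ∀ j, j ≤ M → ∀ i, U j i 0 = 0 ∧ U j i Ny = 0)
    (hscheme : ∀ j < M, ∀ i, 1 ≤ i → i ≤ Nx - 1 → ∀ l, 1 ≤ l → l ≤ Ny - 1 →
      driftD σ τ (fun m => U m i l) j + fracD α σ τ (fun m => U m i l) j
        = σ * lam2D d k q hx hy (((j : ℝ) + σ) * τ) (U (j + 1)) i l
          + (1 - σ) * lam2D d k q hx hy (((j : ℝ) + σ) * τ) (U j) i l
          + f ((i : ℝ) * hx) ((l : ℝ) * hy) (((j : ℝ) + σ) * τ)) :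
    nrm2D hx hy Nx Ny (U 1)
      ≤ (4 * T ^ (1 - α) * σ ^ α / Real.Gamma (2 - α) + 2 * σ) * nrm2D hx hy Nx Ny (U 0)
        + 4 * σ ^ α * T ^ (1 + α) * Real.Gamma (2 - α) *
            (hx * hy * ∑ i ∈ Finset.Icc 1 (Nx - 1), ∑ l ∈ Finset.Icc 1 (Ny - 1),
              (f ((i : ℝ) * hx) ((l : ℝ) * hy) (σ * τ)) ^ 2) := by
  obtain ⟨hα₀, hα₁⟩ := hα
  have hG : 0 < Real.Gamma (2 - α) := Real.Gamma_pos_of_pos (by linarith)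
  have hMr : (1 : ℝ) ≤ M := by exact_mod_cast hM
  have hτ₀ : 0 < τ := by rw [hτ]; positivity
  have hτT : τ ≤ T := by rw [hτ]; exact div_le_self hT.le hMr
  have hσ₀ : 1 / 2 ≤ σ := by linarith
  have hσ₁ : σ ≤ 1 := by linarith
  have hNx' : (2 : ℝ) ≤ Nx := by exact_mod_cast hNx
  have hNy' : (2 : ℝ) ≤ Ny := by exact_mod_cast hNy
  have hx₀ : 0 < hx := by rw [hhx]; positivity
  have hy₀ : 0 < hy := by rw [hhy]; positivity
  have hLx' : Lx = Nx * hx := by rw [hhx]; field_simp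
  have hLy' : Ly = Ny * hy := by rw [hhy]; field_simp
  have ht : σ * τ ∈ Set.Icc 0 T := ⟨by positivity, by nlinarith⟩
  have node : ∀ {N : ℕ} {h L : ℝ}, 0 < h → L = N * h → ∀ i ∈ Finset.Icc 1 (N - 1),
      (i : ℝ) * h ∈ Set.Icc 0 L := by
    intro N h L h₀ hL i hi
    rw [Finset.mem_Icc] at hi
    have : (i : ℝ) ≤ N := by exact_mod_cast (by omega : i ≤ N)
    exact ⟨by positivity, by rw [hL]; gcongr⟩
  have midpoint : ∀ {N : ℕ} {h L : ℝ}, 0 < h → L = N * h → ∀ i < N,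
      (i : ℝ) * h + h / 2 ∈ Set.Icc 0 L := by
    intro N h L h₀ hL i hi
    have : (i : ℝ) + 1 ≤ N := by exact_mod_cast hi
    exact ⟨by positivity, by rw [hL]; nlinarith⟩
  set W : ℕ → ℕ → ℝ := fun i l => σ * U 1 i l + (1 - σ) * U 0 i l with hW
  have hdiss : ∑ i ∈ Finset.Icc 1 (Nx - 1), ∑ l ∈ Finset.Icc 1 (Ny - 1),
      lam2D d k q hx hy (σ * τ) W i l * W i l ≤ 0 := by
    refine sum_lam2D_mul_nonpos d k q hx hy (σ * τ) Nx Ny W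
      (fun i hi l hl => hC₃.le.trans
        (hd _ (midpoint hx₀ hLx' i hi) _ (node hy₀ hLy' l hl) _ ht))
      (fun i hi l hl => hC₄.le.trans
        (hk _ (node hx₀ hLx' i hi) _ (midpoint hy₀ hLy' l hl) _ ht))
      (fun i hi l hl => hq _ (node hx₀ hLx' i hi) _ (node hy₀ hLy' l hl) _ ht)
      (fun l => ?_) (fun i => ?_)
    · simp [hW, hbx 1 hM l, hbx 0 (Nat.zero_le M) l]
    · simp [hW, hby 1 hM i, hby 0 (Nat.zero_le M) i]
  have hconst := source_constant_le hα₀ hα₁ hσ hτ₀ hτT hG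
  set A := (2 * σ + 1) / (2 * τ) + τ ^ (-α) * σ ^ (1 - α) / Real.Gamma (2 - α) with hA
  set ε := 4 * T ^ (1 - α) * σ ^ α / Real.Gamma (2 - α) + (2 * σ - 1) with hε
  set K := 4 * σ ^ α * T ^ (1 + α) * Real.Gamma (2 - α)
  have hσp : 0 < σ := by linarith
  have hA₀ : 0 < A := by positivity
  have hε₀ : 0 < ε := by
    have : 0 < 4 * T ^ (1 - α) * σ ^ α / Real.Gamma (2 - α) := by positivity
    linarith
  have hstep : ∀ i ∈ Finset.Icc 1 (Nx - 1), ∀ l ∈ Finset.Icc 1 (Ny - 1),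
      A * (U 1 i l - U 0 i l)
        = lam2D d k q hx hy (σ * τ) W i l + f ((i : ℝ) * hx) ((l : ℝ) * hy) (σ * τ) := by
    intro i hi l hl
    rw [Finset.mem_Icc] at hi hl
    have h := hscheme 0 (by omega) i hi.1 hi.2 l hl.1 hl.2
    rw [lam2D_linear_comb] at h
    simp only [driftD, fracD, cC, aC, Nat.cast_zero, zero_add, if_true, Finset.sum_range_one,
      Nat.zero_sub] at h
    rw [← hW] at h
    rw [← h, hA]
    field_simp
    ring
  set c := 2 * (1 + ε) / (1 + σ * ε) with hc
  have hc₀ : 0 ≤ c / A := by positivity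
  have hpt : ∀ i ∈ Finset.Icc 1 (Nx - 1), ∀ l ∈ Finset.Icc 1 (Ny - 1),
      (U 1 i l) ^ 2 ≤ (1 + ε) * (U 0 i l) ^ 2
        + K * (f ((i : ℝ) * hx) ((l : ℝ) * hy) (σ * τ)) ^ 2
        + c / A * (lam2D d k q hx hy (σ * τ) W i l * W i l) := by
    intro i hi l hl
    have h1 := sq_le_weighted_step hσ₀ hσ₁ hε₀ (U 1 i l) (U 0 i l)
      (f ((i : ℝ) * hx) ((l : ℝ) * hy) (σ * τ) / A)
    have h2 : U 1 i l - U 0 i l - f ((i : ℝ) * hx) ((l : ℝ) * hy) (σ * τ) / A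
        = lam2D d k q hx hy (σ * τ) W i l / A := by
      have := hstep i hi l hl
      field_simp
      linarith
    rw [h2] at h1
    have h3 : (1 + 1 / ε) * (f ((i : ℝ) * hx) ((l : ℝ) * hy) (σ * τ) / A) ^ 2
        ≤ K * (f ((i : ℝ) * hx) ((l : ℝ) * hy) (σ * τ)) ^ 2 := by
      calc _ ≤ K * A ^ 2 * (f ((i : ℝ) * hx) ((l : ℝ) * hy) (σ * τ) / A) ^ 2 := by gcongr
        _ = _ := by field_simp
    calc _ ≤ _ := h1
      _ ≤ _ := by
        gcongr ?_ + ?_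
        · gcongr
        · exact le_of_eq (by rw [hW]; ring)
  have hsum := Finset.sum_le_sum fun i hi => Finset.sum_le_sum fun l hl => hpt i hi l hl
  simp only [Finset.sum_add_distrib, ← Finset.mul_sum] at hsum
  have h4 := mul_nonpos_of_nonneg_of_nonpos hc₀ hdiss
  have h5 : 4 * T ^ (1 - α) * σ ^ α / Real.Gamma (2 - α) + 2 * σ = 1 + ε := by rw [hε]; ring
  rw [h5]
  simp only [nrm2D]
  have h6 := mul_le_mul_of_nonneg_left (hsum.trans (add_le_of_nonpos_right h4))
    (mul_pos hx₀ hy₀).le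
  linarith
end
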